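/- Let X be a completely regular (Hausdorff) topological space and let H be a non-vanishing self-adjoint closed subalgebra of C_B(X) which separates points from closed sets in X. Then the set λ_H X = ⋃_{h∈H} Coz(h_α) is an open subset of the compactification α_H X, it contains (the image of) X, and λ_H X is a locally compact Hausdorff space. -/

import Mathlib

open Set Topology

/-- `H ⊆ C_B(X)` separates points from closed sets in `X`. -/
def SeparatesPointsFromClosedSets {X : Type*} [TopologicalSpace X]
    (H : Set (BoundedContinuousFunction X ℂ)) : Prop :=
  ∀ C : Set X, IsClosed C → ∀ x ∉ C, ∃ h ∈ H, h x ∉ closure ((h : X → ℂ) '' C)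

/-- The evaluation map `e : X → ∏_{h ∈ H} cl_ℂ(h(X))`. -/
noncomputable def evalMap {X : Type*} [TopologicalSpace X]
    (H : Set (BoundedContinuousFunction X ℂ)) (x : X) :
    (h : H) → (closure (Set.range ((h : BoundedContinuousFunction X ℂ) : X → ℂ)) : Set ℂ) :=
  fun h => ⟨(h : BoundedContinuousFunction X ℂ) x, subset_closure ⟨x, rfl⟩⟩

/-- The compactification `α_H X`, as the closure of `e(X)` in the product. -/
noncomputable def alphaSet {X : Type*} [TopologicalSpace X]
    (H : Set (BoundedContinuousFunction X ℂ)) :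
    Set ((h : H) → (closure (Set.range ((h : BoundedContinuousFunction X ℂ) : X → ℂ)) : Set ℂ)) :=
  closure (Set.range (evalMap H))

/-- The corestriction `X → α_H X` of the evaluation map. -/
noncomputable def evalAlpha {X : Type*} [TopologicalSpace X]
    (H : Set (BoundedContinuousFunction X ℂ)) (x : X) : alphaSet H :=
  ⟨evalMap H x, subset_closure ⟨x, rfl⟩⟩

/-- The extension `h_α : α_H X → ℂ` of `h ∈ H`, i.e. the restriction to `α_H X` of the
projection onto the `h`-th coordinate. -/
noncomputable def hAlpha {X : Type*} [TopologicalSpace X]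
    (H : Set (BoundedContinuousFunction X ℂ)) (h : H) (z : alphaSet H) : ℂ :=
  (z.1 h : ℂ)

/-- The subspace `λ_H X = ⋃_{h ∈ H} Coz(h_α)` of `α_H X`. -/
noncomputable def lambdaSet {X : Type*} [TopologicalSpace X]
    (H : Set (BoundedContinuousFunction X ℂ)) : Set (alphaSet H) :=
  {z : alphaSet H | ∃ h : H, hAlpha H h z ≠ 0}

theorem continuous_hAlpha {X : Type*} [TopologicalSpace X]
    (H : Set (BoundedContinuousFunction X ℂ)) (h : H) : Continuous (hAlpha H h) :=
  continuous_subtype_val.comp ((continuous_apply h).comp continuous_subtype_val)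

theorem isOpen_lambdaSet {X : Type*} [TopologicalSpace X]
    (H : Set (BoundedContinuousFunction X ℂ)) : IsOpen (lambdaSet H) := by
  rw [lambdaSet, ofPred_exists]
  exact isOpen_iUnion fun h => isOpen_ne_fun (continuous_hAlpha H h) continuous_const

theorem compactSpace_alphaSet {X : Type*} [TopologicalSpace X]
    (H : Set (BoundedContinuousFunction X ℂ)) : CompactSpace (alphaSet H) := by
  have (h : H) : CompactSpace
      (closure (Set.range ((h : BoundedContinuousFunction X ℂ) : X → ℂ)) : Set ℂ) :=
    isCompact_iff_compactSpace.mp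
      (BoundedContinuousFunction.isBounded_range h.1).isCompact_closure
  exact isCompact_iff_compactSpace.mp isClosed_closure.isCompact

/-- `λ_H X = ⋃_{h ∈ H} Coz(h_α)` is open in `α_H X`, contains (the image of)
`X`, and is a locally compact Hausdorff space. -/
theorem lambdaSet_isOpen_locallyCompact {X : Type*} [TopologicalSpace X]
    [CompletelyRegularSpace X] [T2Space X]
    (H : NonUnitalStarSubalgebra ℂ (BoundedContinuousFunction X ℂ))
    (hclosed : IsClosed (H : Set (BoundedContinuousFunction X ℂ)))
    (hnv : ∀ x : X, ∃ h ∈ H, h x ≠ 0)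
    (hsep : SeparatesPointsFromClosedSets (H : Set (BoundedContinuousFunction X ℂ))) :
    IsOpen (lambdaSet (H : Set (BoundedContinuousFunction X ℂ))) ∧
    (∀ x : X, evalAlpha (H : Set (BoundedContinuousFunction X ℂ)) x ∈
      lambdaSet (H : Set (BoundedContinuousFunction X ℂ))) ∧
    LocallyCompactSpace (lambdaSet (H : Set (BoundedContinuousFunction X ℂ))) ∧
    T2Space (lambdaSet (H : Set (BoundedContinuousFunction X ℂ))) := by
  have := compactSpace_alphaSet (H : Set (BoundedContinuousFunction X ℂ))
  refine ⟨isOpen_lambdaSet _, fun x => ?_, (isOpen_lambdaSet _).locallyCompactSpace, inferInstance⟩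
  obtain ⟨h, hH, hx⟩ := hnv x
  exact ⟨⟨h, hH⟩, hx⟩
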